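/- arXiv:2602.17579 — 2 statements merged into one kernel-verified Lean document; each statement's English description precedes it below -/
import Mathlib

section
/- Let M be an irreducible generator on a finite set Z with |Z| ≥ 2. The generalised log-Sobolev constant is continuous on P_+(Z): if ζ ∈ P_+(Z) and (ζ_n) is a sequence in P_+(Z) with ζ_n(z) → ζ(z) for every z ∈ Z, then α_gLSI(ζ_n, M) → α_gLSI(ζ, M) as n → ∞. -/
open Finset Filter

/-- A generator (transition rate matrix) on a finite state space `Z`. -/
def IsGenerator {Z : Type*} [Fintype Z] (M : Z → Z → ℝ) : Prop :=
  (∀ z z' : Z, z ≠ z' → 0 ≤ M z z') ∧ ∀ z : Z, ∑ z' : Z, M z z' = 0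

/-- Irreducibility of a generator. -/
def IsIrreducibleGen {Z : Type*} [Fintype Z] (M : Z → Z → ℝ) : Prop :=
  ∀ z z' : Z, z ≠ z' → ∃ (ℓ : ℕ) (p : ℕ → Z), 1 ≤ ℓ ∧ p 0 = z ∧ p ℓ = z' ∧
    ∀ i : ℕ, 1 ≤ i → i ≤ ℓ → 0 < M (p (i - 1)) (p i)

/-- A probability measure on `Z`. -/
def IsProb {Z : Type*} [Fintype Z] (ζ : Z → ℝ) : Prop :=
  (∀ z, 0 ≤ ζ z) ∧ ∑ z : Z, ζ z = 1

/-- A strictly positive probability measure on `Z`. -/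
def IsPosProb {Z : Type*} [Fintype Z] (ζ : Z → ℝ) : Prop :=
  (∀ z, 0 < ζ z) ∧ ∑ z : Z, ζ z = 1

/-- Expectation of `f` with respect to `ζ`. -/
noncomputable def expec {Z : Type*} [Fintype Z] (ζ f : Z → ℝ) : ℝ := ∑ z : Z, f z * ζ z

/-- Variance of `f` with respect to `ζ`. -/
noncomputable def varWrt {Z : Type*} [Fintype Z] (ζ f : Z → ℝ) : ℝ :=
  expec ζ (fun z => f z ^ 2) - (expec ζ f) ^ 2

/-- Generalised Dirichlet form with respect to `ζ`. -/
noncomputable def dirichletForm {Z : Type*} [Fintype Z] (ζ f : Z → ℝ) (M : Z → Z → ℝ) : ℝ :=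
  (1 / 2) * ∑ z : Z, ∑ z' : Z, M z z' * ζ z * (f z - f z') ^ 2

/-- A (strictly positive) probability density with respect to `ζ`. -/
def IsDensity {Z : Type*} [Fintype Z] (ζ φ : Z → ℝ) : Prop :=
  (∀ z, 0 < φ z) ∧ expec ζ φ = 1

/-- Relative entropy with respect to `ζ`. -/
noncomputable def relEnt {Z : Type*} [Fintype Z] (ζ φ : Z → ℝ) : ℝ :=
  ∑ z : Z, φ z * Real.log (φ z) * ζ z

/-- Generalised Fisher information with respect to `ζ`. -/
noncomputable def fisherInfo {Z : Type*} [Fintype Z] (ζ φ : Z → ℝ) (M : Z → Z → ℝ) : ℝ :=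
  ∑ z : Z, ∑ z' : Z, M z z' * ζ z * φ z * (φ z' / φ z - 1 - Real.log (φ z' / φ z))

/-- `f` is a nonconstant function. -/
def Nonconst {Z : Type*} (f : Z → ℝ) : Prop := ∃ z z' : Z, f z ≠ f z'

/-- Generalised Poincaré constant. -/
noncomputable def gPI {Z : Type*} [Fintype Z] (ζ : Z → ℝ) (M : Z → Z → ℝ) : ℝ :=
  sInf { r : ℝ | ∃ f : Z → ℝ, Nonconst f ∧ r = dirichletForm ζ f M / varWrt ζ f }

/-- Generalised log-Sobolev constant. -/
noncomputable def gLSI {Z : Type*} [Fintype Z] (ζ : Z → ℝ) (M : Z → Z → ℝ) : ℝ :=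
  sInf { r : ℝ | ∃ φ : Z → ℝ, IsDensity ζ φ ∧ φ ≠ (fun _ => 1) ∧
    r = fisherInfo ζ φ M / relEnt ζ φ }

/-- The function `x log x - x + 1` is nonnegative on the positive reals. -/
theorem mul_log_sub_add_one_nonneg {x : ℝ} (hx : 0 < x) : 0 ≤ x * Real.log x - x + 1 := by
  have h := mul_le_mul_of_nonneg_left (Real.one_sub_inv_le_log_of_pos hx) hx.le
  rw [mul_sub, mul_inv_cancel₀ hx.ne'] at h
  linarith

/-- The function `x log x - x + 1` vanishes on the positive reals only at `1`. -/
theorem mul_log_sub_add_one_pos {x : ℝ} (hx : 0 < x) (hne : x ≠ 1) :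
    0 < x * Real.log x - x + 1 := by
  have h := Real.log_lt_sub_one_of_pos (inv_pos.mpr hx) (by simpa using hne)
  rw [Real.log_inv] at h
  have h2 := mul_lt_mul_of_pos_left h hx
  rw [mul_sub, mul_inv_cancel₀ hx.ne'] at h2
  linarith

section Comparison

variable {Z : Type*} [Fintype Z] {ζ ζ' φ : Z → ℝ} {M : Z → Z → ℝ} {K : ℝ}

theorem relEnt_eq_sum_mul_log_sub_add_one (hζ : IsPosProb ζ) (hφ : IsDensity ζ φ) :
    relEnt ζ φ = ∑ z, (φ z * Real.log (φ z) - φ z + 1) * ζ z := by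
  have h := hφ.2
  simp only [expec] at h
  simp only [relEnt, add_mul, sub_mul, Finset.sum_add_distrib, Finset.sum_sub_distrib, one_mul,
    h, hζ.2]
  ring

theorem relEnt_pos (hζ : IsPosProb ζ) (hφ : IsDensity ζ φ) (hne : φ ≠ fun _ => 1) :
    0 < relEnt ζ φ := by
  rw [relEnt_eq_sum_mul_log_sub_add_one hζ hφ]
  obtain ⟨z, hz⟩ := Function.ne_iff.mp hne
  exact Finset.sum_pos'
    (fun w _ => mul_nonneg (mul_log_sub_add_one_nonneg (hφ.1 w)) (hζ.1 w).le)
    ⟨z, Finset.mem_univ z, mul_pos (mul_log_sub_add_one_pos (hφ.1 z) hz) (hζ.1 z)⟩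

/-- Each term of the generalised Fisher information, without its weight, is nonnegative. -/
theorem fisherInfo_term_nonneg (hgen : IsGenerator M) (hφ : ∀ z, 0 < φ z) (z z' : Z) :
    0 ≤ M z z' * φ z * (φ z' / φ z - 1 - Real.log (φ z' / φ z)) := by
  by_cases h : z = z'
  · subst h
    simp [div_self (hφ z).ne']
  · have hlog := Real.log_le_sub_one_of_pos (div_pos (hφ z') (hφ z))
    exact mul_nonneg (mul_nonneg (hgen.1 z z' h) (hφ z).le) (by linarith)

theorem fisherInfo_nonneg (hgen : IsGenerator M) (hζ : IsPosProb ζ) (hφ : ∀ z, 0 < φ z) :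
    0 ≤ fisherInfo ζ φ M := by
  refine Finset.sum_nonneg fun z _ => Finset.sum_nonneg fun z' _ => ?_
  have h := mul_nonneg (hζ.1 z).le (fisherInfo_term_nonneg hgen hφ z z')
  linarith

theorem fisherInfo_le_mul (hgen : IsGenerator M) (hφ : ∀ z, 0 < φ z)
    (hle : ∀ z, ζ' z ≤ K * ζ z) : fisherInfo ζ' φ M ≤ K * fisherInfo ζ φ M := by
  simp only [fisherInfo, Finset.mul_sum]
  refine Finset.sum_le_sum fun z _ => Finset.sum_le_sum fun z' _ => ?_
  have h := mul_le_mul_of_nonneg_right (hle z) (fisherInfo_term_nonneg hgen hφ z z')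
  linarith

theorem fisherInfo_div_const {c : ℝ} (hc : c ≠ 0) :
    fisherInfo ζ (fun z => φ z / c) M = fisherInfo ζ φ M / c := by
  simp only [fisherInfo, Finset.sum_div, div_div_div_cancel_right₀ hc]
  refine Finset.sum_congr rfl fun z _ => Finset.sum_congr rfl fun z' _ => ?_
  ring

/-- The normalisation of `φ` with respect to `ζ'` has entropy controlled from below by that of
`φ` with respect to `ζ`. -/
theorem relEnt_div_le_mul (hζ : IsPosProb ζ) (hζ' : IsPosProb ζ') (hφ : IsDensity ζ φ) {c : ℝ}
    (hc : 0 < c) (hφ' : IsDensity ζ' fun z => φ z / c) (hle : ∀ z, ζ z ≤ K * ζ' z) :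
    relEnt ζ φ / c ≤ K * relEnt ζ' fun z => φ z / c := by
  have hsum : ∑ z, (φ z / c * Real.log (φ z / c) - φ z / c + 1) * ζ z
      = relEnt ζ φ / c - Real.log c / c - 1 / c + 1 := by
    have h : ∀ z, (φ z / c * Real.log (φ z / c) - φ z / c + 1) * ζ z
        = φ z * Real.log (φ z) * ζ z / c - φ z * ζ z * (Real.log c / c) - φ z * ζ z / c + ζ z := by
      intro z
      rw [Real.log_div (hφ.1 z).ne' hc.ne']
      ring
    have hE := hφ.2
    simp only [expec] at hE
    simp only [h, Finset.sum_add_distrib, Finset.sum_sub_distrib, ← Finset.sum_div,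
      ← Finset.sum_mul, hE, hζ.2, relEnt, one_mul]
  have hlog : Real.log c / c + 1 / c ≤ 1 := by
    rw [← add_div, div_le_one hc]
    linarith [Real.log_le_sub_one_of_pos hc]
  calc relEnt ζ φ / c ≤ ∑ z, (φ z / c * Real.log (φ z / c) - φ z / c + 1) * ζ z := by
        rw [hsum]
        linarith
    _ ≤ ∑ z, (φ z / c * Real.log (φ z / c) - φ z / c + 1) * (K * ζ' z) :=
        Finset.sum_le_sum fun z _ => mul_le_mul_of_nonneg_left (hle z)
          (mul_log_sub_add_one_nonneg (hφ'.1 z))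
    _ = K * relEnt ζ' fun z => φ z / c := by
        rw [relEnt_eq_sum_mul_log_sub_add_one hζ' hφ', Finset.mul_sum]
        exact Finset.sum_congr rfl fun z _ => by ring

theorem exists_density_ne_one (hcard : 2 ≤ Fintype.card Z) (hζ : IsPosProb ζ) :
    ∃ φ : Z → ℝ, IsDensity ζ φ ∧ φ ≠ fun _ => 1 := by
  classical
  obtain ⟨a, b, hab⟩ := Fintype.one_lt_card_iff.mp hcard
  have : Nonempty Z := ⟨a⟩
  set f : Z → ℝ := fun z => if z = a then 2 else 1 with hf
  have hfpos : ∀ z, 0 < f z := fun z => by simp only [hf]; split_ifs <;> norm_num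
  have hc : 0 < expec ζ f :=
    Finset.sum_pos (fun z _ => mul_pos (hfpos z) (hζ.1 z)) Finset.univ_nonempty
  refine ⟨fun z => f z / expec ζ f, ⟨fun z => div_pos (hfpos z) hc, ?_⟩, fun h => ?_⟩
  · simp only [expec, div_mul_eq_mul_div, ← Finset.sum_div]
    exact div_self hc.ne'
  · have ha := congrFun h a
    have hb := congrFun h b
    simp only [hf, if_true, if_neg hab.symm] at ha hb
    rw [div_eq_one_iff_eq hc.ne'] at ha hb
    linarith

/-- A Holley–Stroock type comparison of generalised log-Sobolev constants. -/
theorem gLSI_le_sq_mul (hcard : 2 ≤ Fintype.card Z) (hgen : IsGenerator M)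
    (hζ : IsPosProb ζ) (hζ' : IsPosProb ζ') (hK : 0 < K)
    (hle : ∀ z, ζ z ≤ K * ζ' z) (hle' : ∀ z, ζ' z ≤ K * ζ z) :
    gLSI ζ' M ≤ K ^ 2 * gLSI ζ M := by
  have hK2 : 0 < K ^ 2 := by positivity
  rw [← div_le_iff₀' hK2]
  obtain ⟨φ₀, hφ₀, hne₀⟩ := exists_density_ne_one hcard hζ
  refine le_csInf ⟨_, φ₀, hφ₀, hne₀, rfl⟩ ?_
  rintro _ ⟨φ, hφ, hne, rfl⟩
  have : Nonempty Z := Fintype.card_pos_iff.mp (by omega)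
  have hc : 0 < expec ζ' φ :=
    Finset.sum_pos (fun z _ => mul_pos (hφ.1 z) (hζ'.1 z)) Finset.univ_nonempty
  set c := expec ζ' φ with hcdef
  have hφ' : IsDensity ζ' fun z => φ z / c := by
    refine ⟨fun z => div_pos (hφ.1 z) hc, ?_⟩
    simp only [expec, div_mul_eq_mul_div, ← Finset.sum_div]
    exact div_self hc.ne'
  have hne' : (fun z => φ z / c) ≠ fun _ => 1 := by
    intro h
    have hconst : ∀ z, φ z = c := fun z => (div_eq_one_iff_eq hc.ne').mp (congrFun h z)
    have hE := hφ.2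
    simp only [expec, hconst, ← Finset.mul_sum, hζ.2, mul_one] at hE
    exact hne (funext fun z => (hconst z).trans hE)
  have hH := relEnt_pos hζ hφ hne
  have hH' := relEnt_pos hζ' hφ' hne'
  have hent := relEnt_div_le_mul hζ hζ' hφ hc hφ' hle
  have hfis := fisherInfo_le_mul hgen hφ.1 hle'
  have hbdd : BddBelow { r : ℝ | ∃ φ : Z → ℝ, IsDensity ζ' φ ∧ φ ≠ (fun _ => 1) ∧
      r = fisherInfo ζ' φ M / relEnt ζ' φ } := by
    refine ⟨0, ?_⟩
    rintro _ ⟨ψ, hψ, hψne, rfl⟩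
    exact div_nonneg (fisherInfo_nonneg hgen hζ' hψ.1) (relEnt_pos hζ' hψ hψne).le
  rw [div_le_iff₀' hK2]
  refine (csInf_le hbdd ⟨_, hφ', hne', rfl⟩).trans ?_
  rw [fisherInfo_div_const hc.ne', div_le_iff₀ hH']
  calc fisherInfo ζ' φ M / c ≤ K * fisherInfo ζ φ M / c := by gcongr
    _ = K * (fisherInfo ζ φ M / relEnt ζ φ) * (relEnt ζ φ / c) := by
        field_simp
    _ ≤ K * (fisherInfo ζ φ M / relEnt ζ φ) * (K * relEnt ζ' fun z => φ z / c) := by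
        have := fisherInfo_nonneg hgen hζ hφ.1
        gcongr
    _ = K ^ 2 * (fisherInfo ζ φ M / relEnt ζ φ) * relEnt ζ' fun z => φ z / c := by ring

end Comparison

/-- continuity of the generalised log-Sobolev constant on
`P₊(Z)` (sequential form). -/
theorem gLSI_continuous
    {Z : Type*} [Fintype Z] (hcard : 2 ≤ Fintype.card Z)
    (M : Z → Z → ℝ) (hgen : IsGenerator M) (hirr : IsIrreducibleGen M)
    (ζ : Z → ℝ) (hζ : IsPosProb ζ)
    (ζseq : ℕ → Z → ℝ) (hζseq : ∀ n, IsPosProb (ζseq n))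
    (hconv : ∀ z : Z, Tendsto (fun n => ζseq n z) atTop (nhds (ζ z))) :
    Tendsto (fun n => gLSI (ζseq n) M) atTop (nhds (gLSI ζ M)) := by
  set K : ℕ → ℝ := fun n => 1 + ∑ z, (|ζseq n z / ζ z - 1| + |ζ z / ζseq n z - 1|) with hKdef
  have hle : ∀ n z, |ζseq n z / ζ z - 1| + |ζ z / ζseq n z - 1| ≤ K n - 1 := fun n z => by
    simp only [hKdef, add_sub_cancel_left]
    exact Finset.single_le_sum
      (f := fun z => |ζseq n z / ζ z - 1| + |ζ z / ζseq n z - 1|)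
      (fun w _ => by positivity) (Finset.mem_univ z)
  have hKpos : ∀ n, 0 < K n := fun n => by positivity
  have hseq_le : ∀ n z, ζseq n z ≤ K n * ζ z := fun n z => by
    rw [← div_le_iff₀ (hζ.1 z)]
    linarith [hle n z, le_abs_self (ζseq n z / ζ z - 1), abs_nonneg (ζ z / ζseq n z - 1)]
  have hle_seq : ∀ n z, ζ z ≤ K n * ζseq n z := fun n z => by
    rw [← div_le_iff₀ ((hζseq n).1 z)]
    linarith [hle n z, le_abs_self (ζ z / ζseq n z - 1), abs_nonneg (ζseq n z / ζ z - 1)]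
  have hKlim : Tendsto K atTop (nhds 1) := by
    have hterm : ∀ z, Tendsto (fun n => |ζseq n z / ζ z - 1| + |ζ z / ζseq n z - 1|) atTop
        (nhds (|ζ z / ζ z - 1| + |ζ z / ζ z - 1|)) := fun z =>
      (((hconv z).div_const _).sub_const 1).abs.add
        ((tendsto_const_nhds.div (hconv z) (hζ.1 z).ne').sub_const 1).abs
    have h := (tendsto_finsetSum Finset.univ fun z _ => hterm z).const_add 1
    simpa [div_self (hζ.1 _).ne'] using h
  have hK2lim : Tendsto (fun n => K n ^ 2) atTop (nhds 1) := by
    simpa using hKlim.pow 2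
  refine tendsto_of_tendsto_of_tendsto_of_le_of_le
    (g := fun n => gLSI ζ M * (K n ^ 2)⁻¹) (h := fun n => K n ^ 2 * gLSI ζ M) ?_ ?_ ?_ ?_
  · simpa using (hK2lim.inv₀ one_ne_zero).const_mul (gLSI ζ M)
  · simpa using hK2lim.mul_const (gLSI ζ M)
  · intro n
    have hpos : 0 < K n ^ 2 := pow_pos (hKpos n) 2
    exact (mul_inv_le_iff₀' hpos).mpr
      (gLSI_le_sq_mul hcard hgen (hζseq n) hζ (hKpos n) (hseq_le n) (hle_seq n))
  · exact fun n => gLSI_le_sq_mul hcard hgen hζ (hζseq n) (hKpos n) (hle_seq n) (hseq_le n)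
end

section
/- Let M be an irreducible generator on a finite set Z with |Z| ≥ 2 and let ζ ∈ P_+(Z). Then the standard log-Sobolev constant of the ζ-symmetrised generator M^ζ satisfies α_gPI(ζ,M) / (2 + log(1/ζ_*)) ≤ α_sLSI(M^ζ) ≤ 2 α_gPI(ζ,M), where ζ_* = min_z ζ(z) (note that α_gPI(ζ,M) equals the spectral gap λ_ζ of −M^ζ, i.e. the classical Poincaré constant of M^ζ with respect to its steady state ζ). -/
open Finset Filter

/-- The `ζ`-symmetrised generator `M^ζ`. -/
noncomputable def symGen {Z : Type*} [Fintype Z] [DecidableEq Z]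
    (ζ : Z → ℝ) (M : Z → Z → ℝ) : Z → Z → ℝ :=
  fun z z' =>
    if z' = z then
      -∑ w ∈ Finset.univ.erase z, (1 / 2) * (M z w + ζ w / ζ z * M w z)
    else (1 / 2) * (M z z' + ζ z' / ζ z * M z' z)

/-- The centred entropy with respect to `ζ`. -/
noncomputable def centEnt {Z : Type*} [Fintype Z] (ζ g : Z → ℝ) : ℝ :=
  relEnt ζ g - expec ζ g * Real.log (expec ζ g)

/-- The standard log-Sobolev constant of a generator `A` with respect to the
weight `ζ`. -/
noncomputable def sLSI {Z : Type*} [Fintype Z] (ζ : Z → ℝ) (A : Z → Z → ℝ) : ℝ :=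
  sInf { r : ℝ | ∃ f : Z → ℝ, (∀ z, 0 < f z) ∧ Nonconst f ∧
    r = dirichletForm ζ f A / centEnt ζ (fun z => f z ^ 2) }

/-- The minimal value of `ζ`. -/
noncomputable def minVal {Z : Type*} (ζ : Z → ℝ) : ℝ := sInf (Set.range ζ)

lemma le_of_hasDerivAt_le_of_one_le {f g f' g' : ℝ → ℝ} (h1 : f 1 ≤ g 1)
    (hf : ∀ x, 1 ≤ x → HasDerivAt f (f' x) x) (hg : ∀ x, 1 ≤ x → HasDerivAt g (g' x) x)
    (hle : ∀ x, 1 ≤ x → f' x ≤ g' x) {x : ℝ} (hx : 1 ≤ x) : f x ≤ g x := by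
  have hmono : MonotoneOn (fun y => g y - f y) (Set.Ici 1) := by
    refine monotoneOn_of_hasDerivWithinAt_nonneg (f' := fun y => g' y - f' y) (convex_Ici 1)
      (fun y hy => ((hg y hy).sub (hf y hy)).continuousAt.continuousWithinAt)
      (fun y hy => ((hg y (interior_subset hy)).sub
        (hf y (interior_subset hy))).hasDerivWithinAt)
      (fun y hy => sub_nonneg.2 (hle y (interior_subset hy)))
  have := hmono (Set.mem_Ici.2 le_rfl) (Set.mem_Ici.2 hx) hx
  simp only at this
  linarith

lemma log_mul_le_of_one_le {x : ℝ} (hx : 1 ≤ x) :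
    (4 * x - 2) * Real.log x ≤ (x - 1) * (3 * x - 1) := by
  have h : Real.log x ≤ (x - 1) * (3 * x - 1) / (4 * x - 2) := by
    refine le_of_hasDerivAt_le_of_one_le (f := Real.log)
      (g := fun x => (x - 1) * (3 * x - 1) / (4 * x - 2))
      (f' := fun x => x⁻¹)
      (g' := fun x => ((6 * x - 4) * (4 * x - 2) - (x - 1) * (3 * x - 1) * 4) / (4 * x - 2) ^ 2)
      (by norm_num) (fun y hy => Real.hasDerivAt_log (by linarith)) (fun y hy => ?_)
      (fun y hy => ?_) hx
    · have h1 : HasDerivAt (fun x : ℝ => (x - 1) * (3 * x - 1)) (6 * y - 4) y := by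
        refine HasDerivAt.congr_deriv (((hasDerivAt_id y).sub_const 1).mul
          (((hasDerivAt_id y).const_mul 3).sub_const 1)) ?_
        simp; ring
      have h2 : HasDerivAt (fun x : ℝ => 4 * x - 2) 4 y := by
        simpa using ((hasDerivAt_id y).const_mul 4).sub_const 2
      exact h1.div h2 (by linarith)
    · have h4 : 0 < 4 * y - 2 := by linarith
      rw [inv_eq_one_div, div_le_div_iff₀ (by linarith) (by positivity)]
      have : 0 ≤ 4 * ((y - 1) ^ 2 * (3 * y - 1)) := by
        have : 0 ≤ 3 * y - 1 := by linarith
        positivity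
      nlinarith [this]
  rw [le_div_iff₀ (by linarith)] at h
  linarith

lemma sq_mul_log_mul_le_of_one_le {x : ℝ} (hx : 1 ≤ x) :
    x ^ 2 * ((2 * x - 1) * Real.log x) ≤ (x - 1) * (x ^ 3 + x - 1) := by
  have h : Real.log x ≤ (x - 1) * (x ^ 3 + x - 1) / (2 * x ^ 3 - x ^ 2) := by
    have hpos : ∀ y : ℝ, 1 ≤ y → 0 < 2 * y ^ 3 - y ^ 2 := fun y hy => by
      have : 2 * y ^ 3 - y ^ 2 = y ^ 2 * (2 * y - 1) := by ring
      rw [this]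
      exact mul_pos (by positivity) (by linarith)
    refine le_of_hasDerivAt_le_of_one_le (f := Real.log)
      (g := fun x => (x - 1) * (x ^ 3 + x - 1) / (2 * x ^ 3 - x ^ 2))
      (f' := fun x => x⁻¹)
      (g' := fun x => ((4 * x ^ 3 - 3 * x ^ 2 + 2 * x - 2) * (2 * x ^ 3 - x ^ 2)
        - (x - 1) * (x ^ 3 + x - 1) * (6 * x ^ 2 - 2 * x)) / (2 * x ^ 3 - x ^ 2) ^ 2)
      (by norm_num) (fun y hy => Real.hasDerivAt_log (by linarith)) (fun y hy => ?_)
      (fun y hy => ?_) hx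
    · have h1 : HasDerivAt (fun x : ℝ => (x - 1) * (x ^ 3 + x - 1))
          (4 * y ^ 3 - 3 * y ^ 2 + 2 * y - 2) y := by
        refine HasDerivAt.congr_deriv (((hasDerivAt_id y).sub_const 1).mul
          (((hasDerivAt_pow 3 y).add (hasDerivAt_id y)).sub_const 1)) ?_
        simp; ring
      have h2 : HasDerivAt (fun x : ℝ => 2 * x ^ 3 - x ^ 2) (6 * y ^ 2 - 2 * y) y := by
        refine HasDerivAt.congr_deriv (((hasDerivAt_pow 3 y).const_mul 2).sub (hasDerivAt_pow 2 y)) ?_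
        simp; ring
      exact h1.div h2 (hpos y hy).ne'
    · have h4 := hpos y hy
      rw [inv_eq_one_div, div_le_div_iff₀ (by linarith) (by positivity)]
      have hq : 0 ≤ 1 - (y - 1) ^ 2 + 4 * (y - 1) ^ 3 + 2 * (y - 1) ^ 4 := by
        have h0 : 0 ≤ y - 1 := by linarith
        nlinarith [mul_nonneg h0 (sq_nonneg (y - 1 - 1 / 3)), pow_nonneg h0 4,
          mul_nonneg h0 (sq_nonneg (y - 1)), sq_nonneg (y - 1 - 1 / 2)]
      have : 0 ≤ y ^ 2 * ((y - 1) * (1 - (y - 1) ^ 2 + 4 * (y - 1) ^ 3 + 2 * (y - 1) ^ 4)) :=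
        mul_nonneg (by positivity) (mul_nonneg (by linarith) hq)
      linear_combination this
  rw [le_div_iff₀ (by nlinarith [sq_nonneg x, mul_nonneg (sq_nonneg x) (sub_nonneg.2 hx)])] at h
  linarith

lemma log_le_two_mul_sub_one_div_add_one {x : ℝ} (h0 : 0 < x) (hx : x ≤ 1) :
    (x + 1) * Real.log x ≤ 2 * (x - 1) := by
  have h := Real.le_log_one_add_of_nonneg (x := x⁻¹ - 1) (sub_nonneg.2 ((one_le_inv₀ h0).2 hx))
  rw [add_sub_cancel, Real.log_inv, div_le_iff₀ (by have := inv_pos.2 h0; linarith)] at h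
  have h2 := mul_le_mul_of_nonneg_left h h0.le
  have h3 : x * x⁻¹ = 1 := mul_inv_cancel₀ h0.ne'
  linear_combination h2 - (2 + Real.log x) * h3

/-- The quadratic upper bound for `x ↦ 2 x² log x` around `1` on `(0, X]`. -/
lemma two_mul_sq_mul_log_le {x X : ℝ} (h0 : 0 < x) (hx : x ≤ X) (hX : 0 < X) :
    2 * x ^ 2 * Real.log x - 2 * (x - 1) ≤
      (x - 1) ^ 2 * (2 + 2 / X ^ 2 + 2 * Real.log X) := by
  have hlogX : 2 * Real.log X = Real.log (X ^ 2) := by rw [Real.log_pow]; norm_num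
  have hlogx : 2 * Real.log x = Real.log (x ^ 2) := by rw [Real.log_pow]; norm_num
  by_cases h2 : x ^ 2 ≤ 2
  · have hlog : 1 + Real.log 2 ≤ 2 / X ^ 2 + 2 * Real.log X := by
      have h := Real.one_sub_inv_le_log_of_pos (x := X ^ 2 / 2) (by positivity)
      rw [Real.log_div (by positivity) (by norm_num), inv_div] at h
      linarith
    rcases le_total 1 x with h1 | h1
    · have hl : 2 * Real.log x ≤ Real.log 2 := by
        rw [hlogx]; exact Real.log_le_log (by positivity) h2
      have := log_mul_le_of_one_le h1
      have h3 : (x - 1) ^ 2 * (3 + 2 * Real.log x) ≤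
          (x - 1) ^ 2 * (2 + 2 / X ^ 2 + 2 * Real.log X) :=
        mul_le_mul_of_nonneg_left (by linarith) (sq_nonneg _)
      nlinarith
    · have hl : 0 ≤ Real.log 2 := Real.log_nonneg (by norm_num)
      have h3 : (x - 1) ^ 2 * 3 ≤ (x - 1) ^ 2 * (2 + 2 / X ^ 2 + 2 * Real.log X) :=
        mul_le_mul_of_nonneg_left (by linarith) (sq_nonneg _)
      refine le_trans ?_ h3
      have h4 := mul_le_mul_of_nonneg_left (log_le_two_mul_sub_one_div_add_one h0 h1)
        (sq_nonneg x)
      refine le_of_mul_le_mul_left ?_ (by linarith : (0 : ℝ) < x + 1)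
      nlinarith [mul_nonneg (sq_nonneg (x - 1)) (sub_nonneg.2 h1)]
  · push Not at h2
    have h1 : 1 ≤ x := by nlinarith
    have hlog : 2 / x ^ 2 + 2 * Real.log x ≤ 2 / X ^ 2 + 2 * Real.log X := by
      have h := Real.one_sub_inv_le_log_of_pos (x := X ^ 2 / x ^ 2) (by positivity)
      rw [Real.log_div (by positivity) (by positivity), inv_div] at h
      have h5 : x ^ 2 / X ^ 2 ≤ 1 := by
        rw [div_le_one (by positivity)]; gcongr
      have h6 : 2 / x ^ 2 ≤ 1 := by rw [div_le_one (by positivity)]; exact h2.le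
      have h7 : 2 / x ^ 2 - 2 / X ^ 2 = 2 / x ^ 2 * (1 - x ^ 2 / X ^ 2) := by
        field_simp
      have h8 := mul_le_mul_of_nonneg_right h6 (sub_nonneg.2 h5)
      linarith
    have h3 : (x - 1) ^ 2 * (2 + (2 / x ^ 2 + 2 * Real.log x)) ≤
        (x - 1) ^ 2 * (2 + 2 / X ^ 2 + 2 * Real.log X) :=
      mul_le_mul_of_nonneg_left (by linarith) (sq_nonneg _)
    refine le_trans ?_ h3
    refine le_of_mul_le_mul_left ?_ (by positivity : (0 : ℝ) < x ^ 2)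
    have h4 := sq_mul_log_mul_le_of_one_le h1
    have h9 : x ^ 2 * ((x - 1) ^ 2 * (2 + (2 / x ^ 2 + 2 * Real.log x))) =
        (x - 1) ^ 2 * (2 * x ^ 2 + 2 + 2 * x ^ 2 * Real.log x) := by
      field_simp
      ring
    rw [h9]
    linear_combination 2 * h4

section FiniteSpace

variable {Z : Type*} [Fintype Z]

lemma dirichletForm_symGen [DecidableEq Z] (M : Z → Z → ℝ) {ζ : Z → ℝ} (hζ : ∀ z, 0 < ζ z)
    (f : Z → ℝ) : dirichletForm ζ f (symGen ζ M) = dirichletForm ζ f M := by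
  have h : ∀ z z', symGen ζ M z z' * ζ z * (f z - f z') ^ 2 =
      (1 / 2) * (M z z' * ζ z * (f z - f z') ^ 2) +
        (1 / 2) * (M z' z * ζ z' * (f z' - f z) ^ 2) := by
    intro z z'
    by_cases hz : z' = z
    · subst hz; simp
    · have := (hζ z).ne'
      simp only [symGen, if_neg hz]
      field_simp
      ring
  unfold dirichletForm
  simp_rw [h, Finset.sum_add_distrib, ← Finset.mul_sum]
  rw [Finset.sum_comm (f := fun z z' => M z' z * ζ z' * (f z' - f z) ^ 2)]
  ring

lemma dirichletForm_nonneg {M : Z → Z → ℝ} (hM : ∀ z z', z ≠ z' → 0 ≤ M z z') {ζ : Z → ℝ}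
    (hζ : ∀ z, 0 < ζ z) (f : Z → ℝ) : 0 ≤ dirichletForm ζ f M := by
  refine mul_nonneg (by norm_num) (sum_nonneg fun z _ => sum_nonneg fun z' _ => ?_)
  by_cases h : z = z'
  · simp [h]
  · exact mul_nonneg (mul_nonneg (hM z z' h) (hζ z).le) (sq_nonneg _)

lemma varWrt_eq {ζ : Z → ℝ} (hζ : IsPosProb ζ) (f : Z → ℝ) :
    varWrt ζ f = ∑ z, (f z - expec ζ f) ^ 2 * ζ z := by
  have h : ∀ z, (f z - expec ζ f) ^ 2 * ζ z =
      f z ^ 2 * ζ z - 2 * expec ζ f * (f z * ζ z) + expec ζ f ^ 2 * ζ z := fun z => by ring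
  simp_rw [h, sum_add_distrib, sum_sub_distrib, ← mul_sum, hζ.2]
  simp only [varWrt, expec]
  ring

lemma varWrt_pos {ζ : Z → ℝ} (hζ : IsPosProb ζ) {f : Z → ℝ} (hf : Nonconst f) :
    0 < varWrt ζ f := by
  rw [varWrt_eq hζ]
  obtain ⟨a, b, hab⟩ := hf
  have h : ∃ z, f z ≠ expec ζ f := by
    by_contra! h
    exact hab ((h a).trans (h b).symm)
  obtain ⟨z, hz⟩ := h
  exact sum_pos' (fun z _ => mul_nonneg (sq_nonneg _) (hζ.1 z).le)
    ⟨z, mem_univ z, mul_pos (by have := sub_ne_zero.2 hz; positivity) (hζ.1 z)⟩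

lemma varWrt_add_const {ζ : Z → ℝ} (hζ : IsPosProb ζ) (f : Z → ℝ) (C : ℝ) :
    varWrt ζ (fun z => f z + C) = varWrt ζ f := by
  have h : expec ζ (fun z => f z + C) = expec ζ f + C := by
    simp only [expec, add_mul, sum_add_distrib, ← mul_sum, hζ.2, mul_one]
  rw [varWrt_eq hζ, varWrt_eq hζ, h]
  simp

lemma expec_const_mul (ζ f : Z → ℝ) (a : ℝ) :
    expec ζ (fun z => a * f z) = a * expec ζ f := by
  simp only [expec, mul_assoc, mul_sum]

lemma varWrt_const_mul (ζ f : Z → ℝ) (a : ℝ) :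
    varWrt ζ (fun z => a * f z) = a ^ 2 * varWrt ζ f := by
  simp only [varWrt, mul_pow, expec_const_mul]
  ring

lemma expec_pos {ζ : Z → ℝ} (hζ : IsPosProb ζ) {f : Z → ℝ} (hf : ∀ z, 0 < f z) :
    0 < expec ζ f := by
  have hne : (univ : Finset Z).Nonempty := by
    by_contra h
    have := hζ.2
    simp [not_nonempty_iff_eq_empty.1 h] at this
  exact sum_pos (fun z _ => mul_pos (hf z) (hζ.1 z)) hne

lemma centEnt_const_mul {ζ : Z → ℝ} (hζ : IsPosProb ζ) {g : Z → ℝ} (hg : ∀ z, 0 < g z)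
    {a : ℝ} (ha : 0 < a) : centEnt ζ (fun z => a * g z) = a * centEnt ζ g := by
  have h : ∀ z, a * g z * Real.log (a * g z) * ζ z =
      a * Real.log a * (g z * ζ z) + a * (g z * Real.log (g z) * ζ z) := fun z => by
    rw [Real.log_mul ha.ne' (hg z).ne']; ring
  have hE := expec_pos hζ hg
  simp only [centEnt, relEnt, expec_const_mul]
  rw [Real.log_mul ha.ne' hE.ne']
  simp_rw [h, sum_add_distrib, ← mul_sum]
  simp only [expec]
  ring

/-- A scaling-invariant comparison of entropy and variance may be checked on normalised
functions. -/
lemma exists_normalised {ζ : Z → ℝ} (hζ : IsPosProb ζ) {f : Z → ℝ} (hf : ∀ z, 0 < f z) :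
    ∃ (a : ℝ) (g : Z → ℝ), 0 < a ∧ (∀ z, 0 < g z) ∧ expec ζ (fun z => g z ^ 2) = 1 ∧
      varWrt ζ f = a * varWrt ζ g ∧
      centEnt ζ (fun z => f z ^ 2) = a * centEnt ζ (fun z => g z ^ 2) := by
  have hS : 0 < expec ζ (fun z => f z ^ 2) := expec_pos hζ fun z => pow_pos (hf z) 2
  set S := expec ζ (fun z => f z ^ 2) with hSdef
  have hs : 0 < √S := Real.sqrt_pos.2 hS
  have hss : √S ^ 2 = S := Real.sq_sqrt hS.le
  have hfg : f = fun z => √S * ((√S)⁻¹ * f z) := by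
    funext z; field_simp
  have hg : ∀ z, 0 < (√S)⁻¹ * f z := fun z => mul_pos (inv_pos.2 hs) (hf z)
  refine ⟨S, fun z => (√S)⁻¹ * f z, hS, hg, ?_, ?_, ?_⟩
  · simp only [mul_pow, expec_const_mul, inv_pow, hss, ← hSdef]
    exact inv_mul_cancel₀ hS.ne'
  · rw [varWrt_const_mul, inv_pow, hss]
    field_simp
  · rw [← centEnt_const_mul hζ (fun z => pow_pos (hg z) 2) hS]
    congr 1
    funext z
    rw [mul_pow, inv_pow, hss]
    field_simp

lemma centEnt_sq_of_normalised {ζ g : Z → ℝ} (h1 : expec ζ (fun z => g z ^ 2) = 1) :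
    centEnt ζ (fun z => g z ^ 2) = ∑ z, g z ^ 2 * Real.log (g z ^ 2) * ζ z := by
  simp [centEnt, relEnt, h1]

lemma varWrt_le_centEnt {ζ : Z → ℝ} (hζ : IsPosProb ζ) {f : Z → ℝ} (hf : ∀ z, 0 < f z) :
    varWrt ζ f ≤ centEnt ζ (fun z => f z ^ 2) := by
  obtain ⟨a, g, ha, hg, h1, hv, he⟩ := exists_normalised hζ hf
  rw [hv, he, centEnt_sq_of_normalised h1]
  refine mul_le_mul_of_nonneg_left ?_ ha.le
  have hle : ∀ z, 2 * (g z ^ 2 * ζ z) - 2 * (g z * ζ z) ≤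
      g z ^ 2 * Real.log (g z ^ 2) * ζ z := fun z => by
    have h := Real.one_sub_inv_le_log_of_pos (hg z)
    have h2 : g z ^ 2 * (1 - (g z)⁻¹) = g z ^ 2 - g z := by
      have := (hg z).ne'
      field_simp
    have h3 := mul_le_mul_of_nonneg_left h (sq_nonneg (g z))
    rw [h2] at h3
    have h4 := mul_le_mul_of_nonneg_right h3 (hζ.1 z).le
    rw [Real.log_pow]
    push_cast
    linarith
  have hsum := sum_le_sum fun z (_ : z ∈ univ) => hle z
  rw [sum_sub_distrib, ← mul_sum, ← mul_sum] at hsum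
  have h1' : ∑ z, g z ^ 2 * ζ z = 1 := h1
  rw [h1'] at hsum
  rw [varWrt, h1]
  have hc : expec ζ g = ∑ z, g z * ζ z := rfl
  nlinarith [sq_nonneg (1 - expec ζ g)]

/-- Entropy is controlled by variance up to the logarithm of the inverse minimal mass. -/
lemma centEnt_le_mul_varWrt {ζ : Z → ℝ} (hζ : IsPosProb ζ) {m : ℝ} (hm0 : 0 < m)
    (hm : ∀ z, m ≤ ζ z) (hm2 : m ≤ 1 / 2) {f : Z → ℝ} (hf : ∀ z, 0 < f z) :
    centEnt ζ (fun z => f z ^ 2) ≤ (2 + Real.log (1 / m)) * varWrt ζ f := by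
  obtain ⟨a, g, ha, hg, h1, hv, he⟩ := exists_normalised hζ hf
  rw [hv, he, centEnt_sq_of_normalised h1, mul_left_comm]
  refine mul_le_mul_of_nonneg_left ?_ ha.le
  have hc : 0 < expec ζ g := expec_pos hζ hg
  have hvar : varWrt ζ g = 1 - expec ζ g ^ 2 := by rw [varWrt, h1]
  have hvar' := varWrt_eq hζ g
  set c := expec ζ g with hcdef
  have hv0 : 0 ≤ varWrt ζ g := by
    rw [hvar']; exact sum_nonneg fun z _ => mul_nonneg (sq_nonneg _) (hζ.1 z).le
  have hsm : 0 < √m := Real.sqrt_pos.2 hm0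
  have hsm2 : √m ^ 2 = m := Real.sq_sqrt hm0.le
  have hX : 0 < 1 / (c * √m) := by positivity
  have hXsq : (1 / (c * √m)) ^ 2 = 1 / (c ^ 2 * m) := by
    rw [div_pow, mul_pow, hsm2, one_pow]
  have hc1 : c ^ 2 ≤ 1 := by linarith
  have hlogX : 2 * Real.log (1 / (c * √m)) = Real.log (1 / m) - Real.log (c ^ 2) := by
    have : 2 * Real.log (1 / (c * √m)) = Real.log ((1 / (c * √m)) ^ 2) := by
      rw [Real.log_pow]; norm_num
    rw [this, hXsq, ← Real.log_div (by positivity) (by positivity)]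
    congr 1
    field_simp
  have hdiv : 2 / (1 / (c * √m)) ^ 2 ≤ c ^ 2 := by
    rw [hXsq, div_div_eq_mul_div, div_one]
    nlinarith [sq_nonneg c]
  have hpt : ∀ z, g z ^ 2 * Real.log (g z ^ 2) * ζ z ≤
      c ^ 2 * Real.log (c ^ 2) * ζ z
        + (2 * c * Real.log (c ^ 2) + 2 * c) * (g z * ζ z - c * ζ z)
        + (2 + Real.log (1 / m) + c ^ 2) * ((g z - c) ^ 2 * ζ z) := fun z => by
    have hgm : g z ^ 2 * m ≤ 1 := by
      calc g z ^ 2 * m ≤ g z ^ 2 * ζ z := mul_le_mul_of_nonneg_left (hm z) (sq_nonneg _)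
        _ ≤ ∑ w, g w ^ 2 * ζ w :=
          single_le_sum (f := fun w => g w ^ 2 * ζ w)
            (fun w _ => mul_nonneg (sq_nonneg _) (hζ.1 w).le) (mem_univ z)
        _ = 1 := h1
    have hgs : g z * √m ≤ 1 := by
      refine (sq_le_one_iff₀ (by have := hg z; positivity)).1 ?_
      rw [mul_pow, hsm2]; exact hgm
    have hx0 : 0 < g z / c := div_pos (hg z) hc
    have hxX : g z / c ≤ 1 / (c * √m) := by
      rw [div_le_div_iff₀ hc (by positivity)]
      nlinarith
    have h := two_mul_sq_mul_log_le hx0 hxX hX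
    have hK : 2 + 2 / (1 / (c * √m)) ^ 2 + 2 * Real.log (1 / (c * √m)) ≤
        2 + Real.log (1 / m) + c ^ 2 - Real.log (c ^ 2) := by linarith
    have h' := h.trans (mul_le_mul_of_nonneg_left hK (sq_nonneg (g z / c - 1)))
    have h'' := mul_le_mul_of_nonneg_left h' (sq_nonneg c)
    obtain ⟨x, hx⟩ : ∃ x, x = g z / c := ⟨_, rfl⟩
    have hgx : g z = c * x := by rw [hx]; field_simp
    rw [← hx] at h'' hx0
    have hlog : Real.log ((c * x) ^ 2) = Real.log (c ^ 2) + 2 * Real.log x := by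
      rw [mul_pow, Real.log_mul (by positivity) (by positivity), Real.log_pow x]
      norm_num
    have h3 := mul_le_mul_of_nonneg_right h'' (hζ.1 z).le
    rw [hgx, hlog]
    linear_combination h3
  have hsum := sum_le_sum fun z (_ : z ∈ univ) => hpt z
  simp only [sum_add_distrib, sum_sub_distrib, ← mul_sum, hζ.2, ← hvar'] at hsum
  have hcs : ∑ z, g z * ζ z = c := rfl
  rw [hcs] at hsum
  have hlc := mul_le_mul_of_nonneg_left (Real.log_le_sub_one_of_pos (pow_pos hc 2)) (sq_nonneg c)
  rw [hvar] at hsum ⊢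
  linarith

lemma minVal_pos {ζ : Z → ℝ} [Nonempty Z] (hζ : ∀ z, 0 < ζ z) : 0 < minVal ζ := by
  obtain ⟨z, hz⟩ := (Set.range_nonempty ζ).csInf_mem (Set.finite_range ζ)
  rw [minVal, ← hz]
  exact hζ z

lemma minVal_le (ζ : Z → ℝ) (z : Z) : minVal ζ ≤ ζ z :=
  csInf_le (Set.finite_range ζ).bddBelow ⟨z, rfl⟩

lemma minVal_le_half {ζ : Z → ℝ} (hζ : IsPosProb ζ) {a b : Z} (hab : a ≠ b) :
    minVal ζ ≤ 1 / 2 := by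
  classical
  have h : ζ a + ζ b ≤ 1 := by
    rw [← hζ.2, ← sum_pair hab]
    exact sum_le_sum_of_subset_of_nonneg (subset_univ _) fun z _ _ => (hζ.1 z).le
  linarith [minVal_le ζ a, minVal_le ζ b]

end FiniteSpace

/-- two-sided bound for the standard log-Sobolev constant of the
`ζ`-symmetrised generator in terms of the generalised Poincaré constant. -/
theorem sLSI_symGen_bounds
    {Z : Type*} [Fintype Z] [DecidableEq Z] (hcard : 2 ≤ Fintype.card Z)
    (M : Z → Z → ℝ) (hgen : IsGenerator M) (hirr : IsIrreducibleGen M)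
    (ζ : Z → ℝ) (hζ : IsPosProb ζ) :
    gPI ζ M / (2 + Real.log (1 / minVal ζ)) ≤ sLSI ζ (symGen ζ M) ∧
      sLSI ζ (symGen ζ M) ≤ 2 * gPI ζ M := by
  classical
  obtain ⟨a, b, hab⟩ := Fintype.exists_pair_of_one_lt_card hcard
  have : Nonempty Z := ⟨a⟩
  have hm0 := minVal_pos hζ.1
  have hm2 := minVal_le_half hζ hab
  have hL : 0 ≤ Real.log (1 / minVal ζ) :=
    Real.log_nonneg (by rw [le_div_iff₀ hm0]; linarith)
  have hD := fun f => dirichletForm_nonneg hgen.1 hζ.1 f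
  have hgPI : ∀ f, Nonconst f → gPI ζ M ≤ dirichletForm ζ f M / varWrt ζ f := fun f hf => by
    refine csInf_le ⟨0, ?_⟩ ⟨f, hf, rfl⟩
    rintro _ ⟨g, hg, rfl⟩
    exact div_nonneg (hD g) (varWrt_pos hζ hg).le
  have hsLSI : ∀ f, (∀ z, 0 < f z) → Nonconst f →
      sLSI ζ (symGen ζ M) ≤ dirichletForm ζ f M / varWrt ζ f := fun f hf hfn => by
    refine le_trans (csInf_le ⟨0, ?_⟩ ⟨f, hf, hfn, rfl⟩) ?_
    · rintro _ ⟨g, hg, hgn, rfl⟩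
      rw [dirichletForm_symGen M hζ.1]
      exact div_nonneg (hD g) ((varWrt_pos hζ hgn).le.trans (varWrt_le_centEnt hζ hg))
    · rw [dirichletForm_symGen M hζ.1]
      exact div_le_div_of_nonneg_left (hD f) (varWrt_pos hζ hfn) (varWrt_le_centEnt hζ hf)
  constructor
  · refine le_csInf ⟨_, fun z => if z = a then 2 else 1, fun z => ?_, ⟨a, b, ?_⟩, rfl⟩ ?_
    · dsimp only; split_ifs <;> norm_num
    · simp [hab.symm]
    · rintro _ ⟨f, hf, hfn, rfl⟩
      have hv := varWrt_pos hζ hfn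
      rw [dirichletForm_symGen M hζ.1]
      calc gPI ζ M / (2 + Real.log (1 / minVal ζ))
          ≤ dirichletForm ζ f M / varWrt ζ f / (2 + Real.log (1 / minVal ζ)) :=
            div_le_div_of_nonneg_right (hgPI f hfn) (by linarith)
        _ = dirichletForm ζ f M / ((2 + Real.log (1 / minVal ζ)) * varWrt ζ f) := by
            rw [div_div, mul_comm]
        _ ≤ _ := div_le_div_of_nonneg_left (hD f) (hv.trans_le (varWrt_le_centEnt hζ hf))
            (centEnt_le_mul_varWrt hζ hm0 (minVal_le ζ) hm2 hf)
  · have hne : { r : ℝ | ∃ f : Z → ℝ, Nonconst f ∧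
        r = dirichletForm ζ f M / varWrt ζ f }.Nonempty :=
      ⟨_, fun z => if z = a then 2 else 1, ⟨a, b, by simp [hab.symm]⟩, rfl⟩
    have h0 : 0 ≤ gPI ζ M := by
      refine le_csInf hne ?_
      rintro _ ⟨g, hg, rfl⟩
      exact div_nonneg (hD g) (varWrt_pos hζ hg).le
    have hle : sLSI ζ (symGen ζ M) ≤ gPI ζ M := by
      refine le_csInf hne ?_
      rintro _ ⟨f, ⟨p, q, hpq⟩, rfl⟩
      obtain ⟨B, hB⟩ := (Set.finite_range f).bddBelow
      have h := hsLSI (fun z => f z + (1 - B))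
        (fun z => by have := hB ⟨z, rfl⟩; linarith) ⟨p, q, by simpa using hpq⟩
      have hd : dirichletForm ζ (fun z => f z + (1 - B)) M = dirichletForm ζ f M := by
        simp [dirichletForm]
      rwa [varWrt_add_const hζ, hd] at h
    linarith
end
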